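/- arXiv:2105.05919 — 4 statements merged into one kernel-verified Lean document; each statement's English description precedes it below -/
import Mathlib

section
/- Let A : ℝ² → Matrix (Fin 2) (Fin 2) ℝ and X : ℝ² → (Fin 2 → ℝ) be continuously differentiable, with A p symmetric ((A p)ᵀ = A p) and trace-free (trace (A p) = 0) for every p. Write ∂_c f for the partial derivative of f in the c-th coordinate direction, and for a 2×2 matrix M set STF M = ½(M + Mᵀ) − ½(trace M) • 1. Define at each point p the matrices: (ℒ_X A)_{ab} = Σ_c X_c ∂_c A_{ab} + Σ_c A_{cb} ∂_a X_c + Σ_c A_{ac} ∂_b X_c (the Lie derivative of A along X), div X = Σ_c ∂_c X_c, and R_{ab} = X_a (Σ_c ∂_c A_{bc}) + ∂_a (Σ_c X_c A_{bc}) + Σ_c A_{ac} · ½(∂_b X_c − ∂_c X_b). Then at every point p, STF(ℒ_X A − ½ (div X) • A) = STF R. -/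
open Matrix

/-- Partial derivative of a real-valued function on `ℝ²` (modelled as `Fin 2 → ℝ`)
in the `c`-th coordinate direction. -/
noncomputable def pd (f : (Fin 2 → ℝ) → ℝ) (c : Fin 2) (p : Fin 2 → ℝ) : ℝ :=
  fderiv ℝ f p (Pi.single c 1)

/-- Symmetric trace-free part of a 2×2 real matrix:
`STF M = ½(M + Mᵀ) − ½(trace M) • 1`. -/
noncomputable def STF (M : Matrix (Fin 2) (Fin 2) ℝ) : Matrix (Fin 2) (Fin 2) ℝ :=
  (1 / 2 : ℝ) • (M + Mᵀ) - ((1 / 2 : ℝ) * M.trace) • (1 : Matrix (Fin 2) (Fin 2) ℝ)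

/-- The flat two-dimensional case of the identity
`STF(ℒ_X A_{ab} − ½ A_{ab} D_c X^c)
  = STF[X_a D^c A_{bc} + D_a(X^c A_{bc}) + A_a{}^c D_{[b} X_{c]}]`
for a symmetric trace-free tensor field `A` and a vector field `X` on the
Euclidean plane. -/
theorem stf_lie_derivative_identity
    (A : (Fin 2 → ℝ) → Matrix (Fin 2) (Fin 2) ℝ)
    (X : (Fin 2 → ℝ) → Fin 2 → ℝ)
    (hA : ∀ a b : Fin 2, ContDiff ℝ 1 (fun p => A p a b))
    (hX : ∀ c : Fin 2, ContDiff ℝ 1 (fun p => X p c))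
    (hAsymm : ∀ p, (A p)ᵀ = A p)
    (hAtr : ∀ p, (A p).trace = 0)
    (p : Fin 2 → ℝ) :
    STF ((Matrix.of fun a b =>
            (∑ c, X p c * pd (fun q => A q a b) c p)
              + (∑ c, A p c b * pd (fun q => X q c) a p)
              + (∑ c, A p a c * pd (fun q => X q c) b p))
          - ((1 / 2 : ℝ) * ∑ c, pd (fun q => X q c) c p) • A p)
      = STF (Matrix.of fun a b =>
            X p a * (∑ c, pd (fun q => A q b c) c p)
              + pd (fun q => ∑ c, X q c * A q b c) a p
              + ∑ c, A p a c *
                  ((1 / 2 : ℝ) * (pd (fun q => X q c) b p - pd (fun q => X q b) c p))) := by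
  have dA : ∀ a b, DifferentiableAt ℝ (fun q => A q a b) p := fun a b =>
    (hA a b).differentiable (by norm_num) p
  have dX : ∀ c, DifferentiableAt ℝ (fun q => X q c) p := fun c =>
    (hX c).differentiable (by norm_num) p
  have prod : ∀ a b, pd (fun q => ∑ c, X q c * A q b c) a p
      = ∑ c, (X p c * pd (fun q => A q b c) a p + A p b c * pd (fun q => X q c) a p) := by
    intro a b
    have h : HasFDerivAt (fun q => ∑ c, X q c * A q b c)
        (∑ c, (X p c • fderiv ℝ (fun q => A q b c) p + A p b c • fderiv ℝ (fun q => X q c) p)) p :=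
      HasFDerivAt.fun_sum fun c _ => (dX c).hasFDerivAt.mul (dA b c).hasFDerivAt
    unfold pd
    rw [h.fderiv]
    simp
  have s10 : ∀ q, A q 1 0 = A q 0 1 := fun q => congrFun (congrFun (hAsymm q) 0) 1
  have t11 : ∀ q, A q 1 1 = - A q 0 0 := fun q => by
    have := hAtr q
    rw [Matrix.trace_fin_two] at this
    linarith
  have n : ∀ c, pd (fun q => - A q 0 0) c p = - pd (fun q => A q 0 0) c p := by
    intro c
    simp [pd, fderiv_fun_neg]
  simp only [prod]
  ext i j
  fin_cases i <;> fin_cases j <;>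
    simp [STF, Matrix.trace_fin_two, Fin.sum_univ_two, s10, t11, n] <;> ring
end

section
/- Let s, C, d be 2×2 real matrices with s invertible. Suppose that, as the real parameter t tends to 0, det (s + t • C + t² • d) − det s = o(t²). Then trace (s⁻¹ * C) = 0 and trace (s⁻¹ * d) = ½ · trace ((s⁻¹ * C) * (s⁻¹ * C)). -/
open Matrix Filter Asymptotics

lemma bondi_aux (k : ℕ) (g : ℝ → ℝ) (hg : Continuous g)
    (h : (fun t : ℝ => t ^ k * g t) =o[nhds 0] fun t : ℝ => t ^ k) : g 0 = 0 := by
  have h1 := (h.mono (nhdsWithin_le_nhds (s := {0}ᶜ))).tendsto_div_nhds_zero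
  have h2 : Tendsto g (nhdsWithin 0 {0}ᶜ) (nhds (g 0)) :=
    (hg.tendsto 0).mono_left nhdsWithin_le_nhds
  refine tendsto_nhds_unique h2 (h1.congr' ?_)
  filter_upwards [self_mem_nhdsWithin] with t ht
  have ht' : t ≠ 0 := ht
  field_simp

lemma bondi_aux2 (a b c e : ℝ)
    (h : (fun t : ℝ => a * t + b * t ^ 2 + c * t ^ 3 + e * t ^ 4) =o[nhds 0]
      fun t : ℝ => t ^ 2) : a = 0 ∧ b = 0 := by
  have ha : a = 0 := by
    have h0 : (fun t : ℝ => t ^ 2) =o[nhds 0] fun t : ℝ => t ^ 1 :=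
      isLittleO_pow_pow (by norm_num)
    have := bondi_aux 1 (fun t => a + b * t + c * t ^ 2 + e * t ^ 3) (by fun_prop)
      ((h.trans h0).congr_left (fun t => by ring))
    simpa using this
  refine ⟨ha, ?_⟩
  subst ha
  have := bondi_aux 2 (fun t => b + c * t + e * t ^ 2) (by fun_prop)
    (h.congr_left (fun t => by ring))
  simpa using this

/-- The determinant condition of conformal Bondi–Sachs coordinates: if
`det (s + t•C + t²•d) − det s = o(t²)` as `t → 0` with `s` invertible, then
`trace (s⁻¹ C) = 0` and `trace (s⁻¹ d) = ½ trace ((s⁻¹ C)(s⁻¹ C))`. -/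
theorem bondi_determinant_conditions (s C d : Matrix (Fin 2) (Fin 2) ℝ)
    (hs : IsUnit s.det)
    (h : (fun t : ℝ => (s + t • C + t ^ 2 • d).det - s.det) =o[nhds 0] fun t : ℝ => t ^ 2) :
    (s⁻¹ * C).trace = 0 ∧
      (s⁻¹ * d).trace = (1 / 2 : ℝ) * ((s⁻¹ * C) * (s⁻¹ * C)).trace := by
  have hne : s.det ≠ 0 := hs.ne_zero
  have key : ∀ X : Matrix (Fin 2) (Fin 2) ℝ, (s⁻¹ * X).trace =
      s.det⁻¹ * (s 1 1 * X 0 0 - s 0 1 * X 1 0 - s 1 0 * X 0 1 + s 0 0 * X 1 1) := by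
    intro X
    rw [Matrix.inv_def, Ring.inverse_eq_inv', Matrix.smul_mul, Matrix.trace_smul, smul_eq_mul]
    congr 1
    rw [Matrix.trace_fin_two, Matrix.mul_apply, Matrix.mul_apply, Fin.sum_univ_two, Fin.sum_univ_two]
    simp [Matrix.adjugate_fin_two]
    ring
  have sq : ∀ M : Matrix (Fin 2) (Fin 2) ℝ, (M * M).trace = M.trace ^ 2 - 2 * M.det := by
    intro M
    simp [Matrix.trace_fin_two, Matrix.mul_apply, Fin.sum_univ_two, Matrix.det_fin_two]
    ring
  obtain ⟨ha, hb⟩ := bondi_aux2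
    (s 1 1 * C 0 0 - s 0 1 * C 1 0 - s 1 0 * C 0 1 + s 0 0 * C 1 1)
    ((s 1 1 * d 0 0 - s 0 1 * d 1 0 - s 1 0 * d 0 1 + s 0 0 * d 1 1) + C.det)
    (C 1 1 * d 0 0 - C 0 1 * d 1 0 - C 1 0 * d 0 1 + C 0 0 * d 1 1) d.det
    (h.congr_left (fun t => by
      simp [Matrix.det_fin_two]
      ring))
  have h1 : (s⁻¹ * C).trace = 0 := by rw [key, ha, mul_zero]
  refine ⟨h1, ?_⟩
  rw [sq, h1, key, Matrix.det_mul, Matrix.det_nonsing_inv, Ring.inverse_eq_inv',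
    eq_neg_of_add_eq_zero_left hb]
  ring
end

section
/- Let γ : ℝ → ℝ × ℝ satisfy γ 0 = (0, 0), γ t ≠ (0, 0) for all t ∈ (0, 1], and suppose γ has a one-sided derivative v at 0 from the right (HasDerivWithinAt γ v (Set.Ici 0) 0) with v ≠ 0. Then the function t ↦ (γ t).1 / ‖γ t‖ tends to v.1 / ‖v‖ as t → 0 from the right; that is, Q(γ t) → v.1/‖v‖ as t → 0⁺, where Q (x, y) = x / √(x² + y²). -/
open Filter

/-- Along a curve `γ` leaving the origin with nonzero right tangent vector `v`,
the function `Q(x,y) = x/√(x²+y²)` tends to `v₁/‖v‖`, the cosine of the angle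
the tangent makes with the x-axis. -/
theorem Q_tendsto_cos_tangent_angle (γ : ℝ → ℝ × ℝ) (v : ℝ × ℝ)
    (h0 : γ 0 = (0, 0))
    (hne : ∀ t ∈ Set.Ioc (0 : ℝ) 1, γ t ≠ (0, 0))
    (hderiv : HasDerivWithinAt γ v (Set.Ici 0) 0)
    (hv : v ≠ 0) :
    Tendsto (fun t => (γ t).1 / Real.sqrt ((γ t).1 ^ 2 + (γ t).2 ^ 2))
      (nhdsWithin 0 (Set.Ioi 0))
      (nhds (v.1 / Real.sqrt (v.1 ^ 2 + v.2 ^ 2))) := by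
  have hs := (hasDerivWithinAt_iff_tendsto_slope' (by simp)).1
    (hderiv.mono Set.Ioi_subset_Ici_self)
  have hpos : 0 < v.1 ^ 2 + v.2 ^ 2 := by
    by_contra hcon
    apply hv
    have h1 : v.1 = 0 := by nlinarith [sq_nonneg v.1, sq_nonneg v.2]
    have h2 : v.2 = 0 := by nlinarith [sq_nonneg v.1, sq_nonneg v.2]
    exact Prod.ext h1 h2
  have ha := (continuous_fst.tendsto v).comp hs
  have hb := (continuous_snd.tendsto v).comp hs
  have hq := ha.div ((ha.pow 2).add (hb.pow 2)).sqrt (Real.sqrt_pos.2 hpos).ne'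
  refine hq.congr' ?_
  filter_upwards [self_mem_nhdsWithin] with t ht
  have ht : 0 < t := ht
  have e1 : (slope γ 0 t).1 = t⁻¹ * (γ t).1 := by simp [slope_def_module, h0]
  have e2 : (slope γ 0 t).2 = t⁻¹ * (γ t).2 := by simp [slope_def_module, h0]
  have hti : 0 < t⁻¹ := inv_pos.2 ht
  simp only [Pi.div_apply, Function.comp_apply, e1, e2]
  rw [show (t⁻¹ * (γ t).1) ^ 2 + (t⁻¹ * (γ t).2) ^ 2
      = (t⁻¹) ^ 2 * ((γ t).1 ^ 2 + (γ t).2 ^ 2) by ring,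
    Real.sqrt_mul (sq_nonneg _), Real.sqrt_sq hti.le, mul_div_mul_left _ _ hti.ne']
end

section
/- Let γ : ℝ → ℝ × ℝ be continuously differentiable on [0, 1] with γ 0 = (0, 0), γ 1 = (1, 1), γ t ≠ (0, 0) for all t ∈ (0, 1], and derivative v = γ' 0 ≠ 0 at 0. Then the improper line integral of ω along γ exists and equals lim_{ε → 0⁺} ∫_{ε}^{1} [((γ t).2)² · (γ' t).1 − (γ t).1 · (γ t).2 · (γ' t).2] / (((γ t).1)² + ((γ t).2)²)^{3/2} dt = 1/√2 − v.1/‖v‖. -/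
open Filter intervalIntegral

/-- The paper's counterexample on the plane: for a continuously differentiable
curve `γ` from the origin to `(1,1)` avoiding the origin for `t ∈ (0,1]`, with
nonzero tangent vector `v = γ' 0` at the origin, the improper line integral of
the closed 1-form `ω_{(x,y)}(h,k) = (y² h − x y k)/(x²+y²)^{3/2}` along `γ`
exists and equals `1/√2 − v₁/‖v‖`, which depends on the tangent direction. -/
theorem line_integral_omega_depends_on_tangent
    (γ : ℝ → ℝ × ℝ) (γ' : ℝ → ℝ × ℝ)
    (hsmooth : ContDiffOn ℝ 1 γ (Set.Icc 0 1))
    (hderiv : ∀ t ∈ Set.Icc (0 : ℝ) 1, HasDerivWithinAt γ (γ' t) (Set.Icc 0 1) t)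
    (h0 : γ 0 = (0, 0)) (h1 : γ 1 = (1, 1))
    (hne : ∀ t ∈ Set.Ioc (0 : ℝ) 1, γ t ≠ (0, 0))
    (hv : γ' 0 ≠ 0) :
    Tendsto
      (fun ε : ℝ => ∫ t in ε..1,
        (((γ t).2) ^ 2 * (γ' t).1 - (γ t).1 * (γ t).2 * (γ' t).2)
          / (((γ t).1) ^ 2 + ((γ t).2) ^ 2) ^ ((3 : ℝ) / 2))
      (nhdsWithin 0 (Set.Ioi 0))
      (nhds (1 / Real.sqrt 2 - (γ' 0).1 / Real.sqrt ((γ' 0).1 ^ 2 + (γ' 0).2 ^ 2))) := by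
  have hI : ∀ t ∈ Set.Icc (0:ℝ) 1, t ∈ Set.Icc (0:ℝ) 1 := fun t h => h
  have hγc : ContinuousOn γ (Set.Icc 0 1) := hsmooth.continuousOn
  have hγ'c : ContinuousOn γ' (Set.Icc 0 1) := by
    have h := hsmooth.continuousOn_derivWithin (uniqueDiffOn_Icc zero_lt_one) le_rfl
    refine h.congr ?_
    intro t ht
    exact ((hderiv t ht).derivWithin (uniqueDiffOn_Icc zero_lt_one t ht)).symm
  have hpos : ∀ p : ℝ × ℝ, p ≠ (0, 0) → 0 < p.1 ^ 2 + p.2 ^ 2 := by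
    rintro ⟨a, b⟩ h
    by_contra hh
    apply h
    simp only [not_lt] at hh
    have ha : a = 0 := by nlinarith [sq_nonneg a, sq_nonneg b]
    have hb : b = 0 := by nlinarith [sq_nonneg a, sq_nonneg b]
    simp [ha, hb]
  have hpow : ∀ s : ℝ, 0 < s → s ^ ((3:ℝ)/2) = Real.sqrt s ^ 3 := by
    intro s hs
    rw [Real.sqrt_eq_rpow, ← Real.rpow_natCast, ← Real.rpow_mul hs.le]
    norm_num
  let Q : ℝ × ℝ → ℝ := fun p => p.1 / Real.sqrt (p.1 ^ 2 + p.2 ^ 2)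
  have hQc : ∀ p : ℝ × ℝ, p ≠ (0, 0) → ContinuousAt Q p := by
    intro p hp
    have : Real.sqrt (p.1 ^ 2 + p.2 ^ 2) ≠ 0 := (Real.sqrt_pos.2 (hpos p hp)).ne'
    refine ContinuousAt.div (by fun_prop) (by fun_prop) this
  -- fundamental theorem of calculus
  have hFTC : ∀ ε ∈ Set.Ioo (0:ℝ) 1, (∫ t in ε..1,
        (((γ t).2) ^ 2 * (γ' t).1 - (γ t).1 * (γ t).2 * (γ' t).2)
          / (((γ t).1) ^ 2 + ((γ t).2) ^ 2) ^ ((3 : ℝ) / 2)) = Q (γ 1) - Q (γ ε) := by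
    intro ε hε
    have hsub : Set.Icc ε 1 ⊆ Set.Icc 0 1 := Set.Icc_subset_Icc_left hε.1.le
    have hn : ∀ t ∈ Set.Icc ε 1, γ t ≠ (0, 0) := fun t ht =>
      hne t ⟨hε.1.trans_le ht.1, ht.2⟩
    refine integral_eq_sub_of_hasDerivAt_of_le (f := fun t => Q (γ t)) hε.2.le ?_ ?_ ?_
    · intro t ht
      exact (hQc _ (hn t ht)).comp_continuousWithinAt ((hγc.mono hsub) t ht)
    · intro t ht
      have hd : HasDerivAt γ (γ' t) t :=
        (hderiv t (hsub ⟨ht.1.le, ht.2.le⟩)).hasDerivAt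
          (Icc_mem_nhds (hε.1.trans ht.1) ht.2)
      have hp := hpos _ (hn t ⟨ht.1.le, ht.2.le⟩)
      have hx : HasDerivAt (fun s => (γ s).1) (γ' t).1 t := hd.fst
      have hy : HasDerivAt (fun s => (γ s).2) (γ' t).2 t := hd.snd
      have hr := Real.sqrt_pos.2 hp
      have hs := (((hx.pow 2).add (hy.pow 2)).sqrt hp.ne')
      have hq := hx.div hs hr.ne'
      refine hq.congr_deriv ?_
      rw [hpow _ hp]
      simp only [Pi.add_apply, Pi.pow_apply]
      have hsq := Real.sq_sqrt hp.le
      generalize Real.sqrt ((γ t).1 ^ 2 + (γ t).2 ^ 2) = r at *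
      field_simp
      rw [hsq]
      push_cast
      ring
    · apply ContinuousOn.intervalIntegrable
      rw [Set.uIcc_of_le hε.2.le]
      have h1 := hγc.mono hsub
      have h2 := hγ'c.mono hsub
      refine ContinuousOn.div (by fun_prop) ?_ ?_
      · refine ContinuousOn.rpow_const (by fun_prop) ?_
        intro t ht
        exact Or.inl (hpos _ (hn t ht)).ne'
      · intro t ht
        exact (Real.rpow_pos_of_pos (hpos _ (hn t ht)) _).ne'
  have hlim : Tendsto (fun ε => Q (γ ε)) (nhdsWithin 0 (Set.Ioi 0)) (nhds (Q (γ' 0))) := by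
    have hd : HasDerivWithinAt γ (γ' 0) (Set.Ioi 0) 0 := by
      have h := (hderiv 0 (by simp)).mono (Set.Ioo_subset_Icc_self)
      exact h.mono_of_mem_nhdsWithin (Ioo_mem_nhdsGT zero_lt_one)
    rw [hasDerivWithinAt_iff_tendsto_slope' (by simp)] at hd
    have h := (hQc (γ' 0) hv).tendsto.comp hd
    refine h.congr' ?_
    filter_upwards [self_mem_nhdsWithin] with t ht
    have ht : 0 < t := ht
    simp only [Function.comp, Q, slope, h0, vsub_eq_sub, sub_zero, Prod.smul_fst, Prod.smul_snd,
      smul_eq_mul, Prod.fst_sub, Prod.snd_sub]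
    rw [mul_pow, mul_pow, ← mul_add, Real.sqrt_mul (by positivity), Real.sqrt_sq (by positivity)]
    exact mul_div_mul_left _ _ (by positivity)
  have hQ1 : Q (γ 1) = 1 / Real.sqrt 2 := by
    simp only [Q, h1]; norm_num
  have := (tendsto_const_nhds (x := Q (γ 1))).sub hlim
  rw [hQ1] at this
  refine this.congr' ?_
  filter_upwards [Ioo_mem_nhdsGT (zero_lt_one (α := ℝ))] with ε hε
  rw [hFTC ε hε, hQ1]
end
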